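/- arXiv:2112.10563 — 5 statements merged into one kernel-verified Lean document; each statement's English description precedes it below -/
import Mathlib

section
/- For every p ≥ 2, the positive part of the Burkholder integrand B_p⁺ = max{B_p, 0} : ℝ^{2×2} → [0,∞) is polyconvex: there exists a convex function G : ℝ^{2×2} × ℝ → ℝ such that B_p⁺(A) = G(A, det A) for every A ∈ ℝ^{2×2}. -/
open Matrix MeasureTheory Set

/-- The operator norm `|A| = max_{|ξ|=1} |Aξ|` of a square matrix, computed via the
Euclidean spaces. -/
noncomputable def opNorm {n : ℕ} (A : Matrix (Fin n) (Fin n) ℝ) : ℝ :=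
  ‖LinearMap.toContinuousLinearMap (Matrix.toEuclideanLin A)‖

/-- `F` is rank-one convex: `t ↦ F (A + t • X)` is convex whenever `rank X = 1`. -/
def RankOneConvex {n : ℕ} (F : Matrix (Fin n) (Fin n) ℝ → ℝ) : Prop :=
  ∀ A X : Matrix (Fin n) (Fin n) ℝ, X.rank = 1 →
    ConvexOn ℝ Set.univ (fun t : ℝ => F (A + t • X))

/-- `F` is isotropic: `F (Q * A * R) = F A` for all `Q, R ∈ SO(n)`. -/
def Isotropic {n : ℕ} (F : Matrix (Fin n) (Fin n) ℝ → ℝ) : Prop :=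
  ∀ (A Q R : Matrix (Fin n) (Fin n) ℝ),
    Qᵀ * Q = 1 → Q.det = 1 → Rᵀ * R = 1 → R.det = 1 → F (Q * A * R) = F A

/-- `F` is positively `p`-homogeneous: `F (t • A) = t ^ p * F A` for `t > 0`. -/
def PosHomogeneous {n : ℕ} (p : ℝ) (F : Matrix (Fin n) (Fin n) ℝ → ℝ) : Prop :=
  ∀ (A : Matrix (Fin n) (Fin n) ℝ) (t : ℝ), 0 < t → F (t • A) = t ^ p * F A

/-- The set `CO(n) = {t • Q : Q ∈ O(n), t ∈ ℝ}` of conformal matrices. -/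
def ConformalSet (n : ℕ) : Set (Matrix (Fin n) (Fin n) ℝ) :=
  {A | ∃ (t : ℝ) (Q : Matrix (Fin n) (Fin n) ℝ), Qᵀ * Q = 1 ∧ A = t • Q}

/-- The matrix `Īd = diag(1, …, 1, -1)`. -/
noncomputable def Ibar (n : ℕ) : Matrix (Fin n) (Fin n) ℝ :=
  Matrix.diagonal (fun i => if (i : ℕ) = n - 1 then -1 else 1)

/-- The Burkholder integrand `B_p(A) = (|1 - n/p| |A|^n + det A) |A|^(p-n)`, with
`B_p(0) = 0`. -/
noncomputable def Burk (n : ℕ) (p : ℝ) (A : Matrix (Fin n) (Fin n) ℝ) : ℝ :=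
  if A = 0 then 0
  else (|1 - (n : ℝ) / p| * opNorm A ^ (n : ℕ) + A.det) * opNorm A ^ (p - (n : ℝ))

/-- The conformal part of a planar matrix, as a complex number. -/
noncomputable def conformalPart (A : Matrix (Fin 2) (Fin 2) ℝ) : ℂ :=
  ⟨(A 0 0 + A 1 1) / 2, (A 1 0 - A 0 1) / 2⟩

/-- The anticonformal part of a planar matrix, as a complex number. -/
noncomputable def anticonformalPart (A : Matrix (Fin 2) (Fin 2) ℝ) : ℂ :=
  ⟨(A 0 0 - A 1 1) / 2, (A 1 0 + A 0 1) / 2⟩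

lemma det_eq_sq_norm_sub_sq_norm (A : Matrix (Fin 2) (Fin 2) ℝ) :
    A.det = ‖conformalPart A‖ ^ 2 - ‖anticonformalPart A‖ ^ 2 := by
  rw [Matrix.det_fin_two, Complex.sq_norm, Complex.sq_norm, Complex.normSq_apply,
    Complex.normSq_apply]
  simp only [conformalPart, anticonformalPart]
  ring

lemma norm_sq_toEuclideanLin_apply (A : Matrix (Fin 2) (Fin 2) ℝ)
    (x : EuclideanSpace ℝ (Fin 2)) :
    ‖Matrix.toEuclideanLin A x‖ ^ 2 =
      (‖conformalPart A‖ ^ 2 + ‖anticonformalPart A‖ ^ 2) * ‖x‖ ^ 2 +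
      2 * (conformalPart A * (starRingEnd ℂ) (anticonformalPart A) *
        (⟨x 0, x 1⟩ : ℂ) ^ 2).re := by
  rw [EuclideanSpace.norm_sq_eq, EuclideanSpace.norm_sq_eq, Complex.sq_norm, Complex.sq_norm,
    Complex.normSq_apply, Complex.normSq_apply]
  simp [Fin.sum_univ_two, Matrix.toLpLin_apply, conformalPart,
    anticonformalPart, pow_two]
  ring

/-- The operator norm of a planar matrix is the sum of the moduli of its conformal and
anticonformal parts. -/
lemma opNorm_eq_norm_add_norm (A : Matrix (Fin 2) (Fin 2) ℝ) :
    opNorm A = ‖conformalPart A‖ + ‖anticonformalPart A‖ := by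
  have norm_eq : ∀ x : EuclideanSpace ℝ (Fin 2), ‖(⟨x 0, x 1⟩ : ℂ)‖ = ‖x‖ := fun x ↦ by
    rw [← sq_eq_sq₀ (norm_nonneg _) (norm_nonneg _), EuclideanSpace.norm_sq_eq, Complex.sq_norm,
      Complex.normSq_apply]
    simp [Fin.sum_univ_two, pow_two]
  set u := conformalPart A * (starRingEnd ℂ) (anticonformalPart A) with hu
  have norm_u : ‖u‖ = ‖conformalPart A‖ * ‖anticonformalPart A‖ := by
    rw [hu, norm_mul, RCLike.norm_conj]
  unfold opNorm
  apply le_antisymm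
  · refine ContinuousLinearMap.opNorm_le_bound _ (by positivity) fun x ↦ ?_
    refine le_of_sq_le_sq ?_ (by positivity)
    rw [LinearMap.coe_toContinuousLinearMap', norm_sq_toEuclideanLin_apply, ← hu]
    have h : (u * (⟨x 0, x 1⟩ : ℂ) ^ 2).re ≤ ‖u‖ * ‖x‖ ^ 2 := by
      refine (Complex.re_le_norm _).trans_eq ?_
      rw [norm_mul, norm_pow, norm_eq]
    rw [norm_u] at h
    nlinarith
  · obtain ⟨ξ, hξ, hmax⟩ : ∃ ξ : ℂ, ξ ≠ 0 ∧ (u * ξ ^ 2).re = ‖u‖ * ‖ξ‖ ^ 2 := by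
      by_cases h : u = 0
      · exact ⟨1, one_ne_zero, by simp [h]⟩
      · obtain ⟨ξ, hξ⟩ := IsAlgClosed.exists_pow_nat_eq ((starRingEnd ℂ) u) zero_lt_two
        refine ⟨ξ, ?_, ?_⟩
        · rintro rfl
          rw [zero_pow two_ne_zero] at hξ
          exact h ((map_eq_zero _).mp hξ.symm)
        · rw [← norm_pow, hξ, RCLike.norm_conj, Complex.mul_conj, Complex.ofReal_re,
            ← Complex.sq_norm, pow_two]
    have key := (LinearMap.toContinuousLinearMap (Matrix.toEuclideanLin A)).le_opNorm
      !₂[ξ.re, ξ.im]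
    have hx := norm_eq !₂[ξ.re, ξ.im]
    have hsq := norm_sq_toEuclideanLin_apply A !₂[ξ.re, ξ.im]
    rw [← hu] at hsq
    have hξ_eq : (⟨(!₂[ξ.re, ξ.im] : EuclideanSpace ℝ (Fin 2)) 0,
        (!₂[ξ.re, ξ.im] : EuclideanSpace ℝ (Fin 2)) 1⟩ : ℂ) = ξ := by
      apply Complex.ext <;> simp
    rw [hξ_eq] at hx hsq
    rw [← hx] at key hsq
    rw [LinearMap.coe_toContinuousLinearMap'] at key
    have hpos : 0 < ‖ξ‖ := norm_pos_iff.mpr hξ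
    refine le_of_mul_le_mul_right (le_trans (le_of_sq_le_sq ?_ (norm_nonneg _)) key) hpos
    rw [hsq, hmax, norm_u]
    apply le_of_eq
    ring

lemma norm_conformalPart_add_norm_anticonformalPart_pos {A : Matrix (Fin 2) (Fin 2) ℝ} (hA : A ≠ 0) :
    0 < ‖conformalPart A‖ + ‖anticonformalPart A‖ := by
  by_contra! h
  have h1 : conformalPart A = 0 := norm_eq_zero.mp (by
    linarith [norm_nonneg (conformalPart A), norm_nonneg (anticonformalPart A)])
  have h2 : anticonformalPart A = 0 := norm_eq_zero.mp (by
    linarith [norm_nonneg (conformalPart A), norm_nonneg (anticonformalPart A)])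
  have a1 := congrArg Complex.re h1
  have a2 := congrArg Complex.im h1
  have a3 := congrArg Complex.re h2
  have a4 := congrArg Complex.im h2
  simp only [conformalPart, anticonformalPart, Complex.zero_re, Complex.zero_im] at a1 a2 a3 a4
  apply hA
  ext i j
  fin_cases i <;> fin_cases j <;> simp <;> linarith

lemma norm_anticonformalPart_combo_le (A B : Matrix (Fin 2) (Fin 2) ℝ) {a b : ℝ}
    (ha : 0 ≤ a) (hb : 0 ≤ b) :
    ‖anticonformalPart (a • A + b • B)‖ ≤
      a * ‖anticonformalPart A‖ + b * ‖anticonformalPart B‖ := by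
  have h : anticonformalPart (a • A + b • B) =
      a • anticonformalPart A + b • anticonformalPart B := by
    apply Complex.ext <;> simp [anticonformalPart] <;> ring
  rw [h]
  refine (norm_add_le _ _).trans_eq ?_
  rw [norm_smul, norm_smul, Real.norm_of_nonneg ha, Real.norm_of_nonneg hb]

/-- The affine functions of `(s, d)`, parametrized by `t`, whose supremum represents the positive
part of the Burkholder integrand in terms of the modulus `s` of the anticonformal part and the
determinant `d`. -/
noncomputable def burkSupport (p s d t : ℝ) : ℝ :=
  (p - 1) * d * t ^ (p - 2) + 2 * (p - 2) * s * t ^ (p - 1) - (p - 1) * (p - 2) / p * t ^ p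

lemma burkSupport_zero {p : ℝ} (hp : 2 < p) (s d : ℝ) : burkSupport p s d 0 = 0 := by
  simp [burkSupport, Real.zero_rpow (by linarith : p - 2 ≠ 0),
    Real.zero_rpow (by linarith : p - 1 ≠ 0), Real.zero_rpow (by linarith : p ≠ 0)]

lemma continuous_burkSupport {p : ℝ} (hp : 2 < p) (s d : ℝ) :
    Continuous (burkSupport p s d) := by
  unfold burkSupport
  have h1 := Real.continuous_rpow_const (by linarith : 0 ≤ p - 2)
  have h2 := Real.continuous_rpow_const (by linarith : 0 ≤ p - 1)
  have h3 := Real.continuous_rpow_const (by linarith : 0 ≤ p)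
  fun_prop

lemma hasDerivAt_burkSupport {p : ℝ} (hp : 2 < p) (s d : ℝ) {t : ℝ} (ht : 0 < t) :
    HasDerivAt (burkSupport p s d)
      ((p - 1) * (p - 2) * t ^ (p - 3) * (s ^ 2 + d - (t - s) ^ 2)) t := by
  have h1 := Real.hasDerivAt_rpow_const (x := t) (p := p - 2) (Or.inl ht.ne')
  have h2 := Real.hasDerivAt_rpow_const (x := t) (p := p - 1) (Or.inl ht.ne')
  have h3 := Real.hasDerivAt_rpow_const (x := t) (p := p) (Or.inl ht.ne')
  refine (((h1.const_mul ((p - 1) * d)).add (h2.const_mul (2 * (p - 2) * s))).sub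
    (h3.const_mul ((p - 1) * (p - 2) / p))).congr_deriv ?_
  have e1 : t ^ (p - 1 - 1) = t ^ (p - 3) * t := by
    rw [← Real.rpow_add_one ht.ne']; ring_nf
  have e2 : t ^ (p - 1) = t ^ (p - 3) * t * t := by
    rw [← Real.rpow_add_one ht.ne', ← Real.rpow_add_one ht.ne']; ring_nf
  have e3 : t ^ (p - 2 - 1) = t ^ (p - 3) := by ring_nf
  rw [e1, e2, e3]
  have : p ≠ 0 := by linarith
  field_simp
  ring

lemma burkSupport_le_of_deriv_nonneg {p : ℝ} (hp : 2 < p) {s d a b : ℝ} (ha : 0 ≤ a) (hab : a ≤ b)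
    (h : ∀ t, a < t → t < b → (t - s) ^ 2 ≤ s ^ 2 + d) :
    burkSupport p s d a ≤ burkSupport p s d b := by
  refine monotoneOn_of_deriv_nonneg (convex_Icc a b) (continuous_burkSupport hp s d).continuousOn
    (fun t ht ↦ ?_) (fun t ht ↦ ?_) (left_mem_Icc.mpr hab) (right_mem_Icc.mpr hab) hab <;>
  rw [interior_Icc] at ht <;> have ht0 : 0 < t := ha.trans_lt ht.1
  · exact (hasDerivAt_burkSupport hp s d ht0).differentiableAt.differentiableWithinAt
  · rw [(hasDerivAt_burkSupport hp s d ht0).deriv]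
    have := h t ht.1 ht.2
    exact mul_nonneg (mul_nonneg (mul_nonneg (by linarith) (by linarith)) (by positivity))
      (by linarith)

lemma burkSupport_le_of_deriv_nonpos {p : ℝ} (hp : 2 < p) {s d a b : ℝ} (ha : 0 ≤ a) (hab : a ≤ b)
    (h : ∀ t, a < t → t < b → s ^ 2 + d ≤ (t - s) ^ 2) :
    burkSupport p s d b ≤ burkSupport p s d a := by
  refine antitoneOn_of_deriv_nonpos (convex_Icc a b) (continuous_burkSupport hp s d).continuousOn
    (fun t ht ↦ ?_) (fun t ht ↦ ?_) (left_mem_Icc.mpr hab) (right_mem_Icc.mpr hab) hab <;>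
  rw [interior_Icc] at ht <;> have ht0 : 0 < t := ha.trans_lt ht.1
  · exact (hasDerivAt_burkSupport hp s d ht0).differentiableAt.differentiableWithinAt
  · rw [(hasDerivAt_burkSupport hp s d ht0).deriv]
    have := h t ht.1 ht.2
    exact mul_nonpos_of_nonneg_of_nonpos
      (mul_nonneg (mul_nonneg (by linarith) (by linarith)) (by positivity)) (by linarith)

/-- The value at `(s, d)` of the supremum over `t ≥ 0` of `burkSupport p s d t`. -/
noncomputable def burkEnvelope (p s d : ℝ) : ℝ :=
  max (burkSupport p s d (s + √(s ^ 2 + d))) 0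

lemma burkSupport_le_burkEnvelope {p : ℝ} (hp : 2 < p) {s d t : ℝ} (hs : 0 ≤ s) (ht : 0 ≤ t) :
    burkSupport p s d t ≤ burkEnvelope p s d := by
  unfold burkEnvelope
  rcases le_total (s ^ 2 + d) 0 with hR | hR
  · refine le_max_of_le_right ?_
    rw [← burkSupport_zero hp s d]
    exact burkSupport_le_of_deriv_nonpos hp le_rfl ht fun x _ _ ↦ hR.trans (sq_nonneg _)
  · have hρ := Real.sq_sqrt hR
    have hρ0 := Real.sqrt_nonneg (s ^ 2 + d)
    set ρ := √(s ^ 2 + d)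
    rcases le_total (s + ρ) t with h | h
    · refine le_max_of_le_left (burkSupport_le_of_deriv_nonpos hp (by positivity) h fun x hx _ ↦ ?_)
      nlinarith
    rcases le_total (s - ρ) t with h' | h'
    · refine le_max_of_le_left (burkSupport_le_of_deriv_nonneg hp ht h fun x hx hx' ↦ ?_)
      nlinarith
    · refine le_max_of_le_right ?_
      rw [← burkSupport_zero hp s d]
      refine burkSupport_le_of_deriv_nonpos hp le_rfl ht fun x _ hx ↦ ?_
      nlinarith

lemma exists_burkSupport_eq_burkEnvelope {p : ℝ} (hp : 2 < p) {s : ℝ} (d : ℝ) (hs : 0 ≤ s) :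
    ∃ t, 0 ≤ t ∧ burkEnvelope p s d = burkSupport p s d t := by
  rcases max_choice (burkSupport p s d (s + √(s ^ 2 + d))) 0 with h | h
  · exact ⟨_, by positivity, h⟩
  · exact ⟨0, le_rfl, h.trans (burkSupport_zero hp s d).symm⟩

lemma convexOn_burkEnvelope {p : ℝ} (hp : 2 < p) :
    ConvexOn ℝ Set.univ fun x : Matrix (Fin 2) (Fin 2) ℝ × ℝ ↦
      burkEnvelope p ‖anticonformalPart x.1‖ x.2 := by
  refine ⟨convex_univ, fun x _ y _ a b ha hb hab ↦ ?_⟩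
  simp only [Prod.fst_add, Prod.snd_add, Prod.smul_fst, Prod.smul_snd, smul_eq_mul]
  obtain ⟨t, ht, h⟩ := exists_burkSupport_eq_burkEnvelope hp (a * x.2 + b * y.2)
    (norm_nonneg (anticonformalPart (a • x.1 + b • y.1)))
  have hx := burkSupport_le_burkEnvelope hp (d := x.2) (norm_nonneg (anticonformalPart x.1)) ht
  have hy := burkSupport_le_burkEnvelope hp (d := y.2) (norm_nonneg (anticonformalPart y.1)) ht
  rw [h]
  refine le_trans ?_ (add_le_add (mul_le_mul_of_nonneg_left hx ha)
    (mul_le_mul_of_nonneg_left hy hb))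
  have hcoef : 0 ≤ 2 * (p - 2) * t ^ (p - 1) := mul_nonneg (by linarith) (by positivity)
  have hs := mul_le_mul_of_nonneg_left (norm_anticonformalPart_combo_le x.1 y.1 ha hb) hcoef
  obtain rfl : b = 1 - a := by linarith
  unfold burkSupport
  linear_combination hs

lemma burkSupport_add {p : ℝ} (hp : 2 ≤ p) {r s : ℝ} (h : 0 < r + s) :
    burkSupport p s (r ^ 2 - s ^ 2) (r + s) =
      ((1 - 2 / p) * (r + s) ^ 2 + (r ^ 2 - s ^ 2)) * (r + s) ^ (p - 2) := by
  have e1 : (r + s) ^ (p - 1) = (r + s) ^ (p - 2) * (r + s) := by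
    rw [← Real.rpow_add_one h.ne']; ring_nf
  have e2 : (r + s) ^ p = (r + s) ^ (p - 2) * (r + s) * (r + s) := by
    rw [← Real.rpow_add_one h.ne', ← Real.rpow_add_one h.ne']; ring_nf
  unfold burkSupport
  rw [e1, e2]
  have : p ≠ 0 := by linarith
  field_simp
  ring

lemma max_Burk_zero_eq_burkEnvelope {p : ℝ} (hp : 2 < p) (A : Matrix (Fin 2) (Fin 2) ℝ) :
    max (Burk 2 p A) 0 = burkEnvelope p ‖anticonformalPart A‖ A.det := by
  have hT : ‖anticonformalPart A‖ + √(‖anticonformalPart A‖ ^ 2 + A.det) =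
      ‖conformalPart A‖ + ‖anticonformalPart A‖ := by
    rw [det_eq_sq_norm_sub_sq_norm, add_sub_cancel, Real.sqrt_sq (norm_nonneg _), add_comm]
  unfold burkEnvelope
  rw [hT]
  congr 1
  by_cases hA : A = 0
  · subst hA
    have h : ‖conformalPart 0‖ + ‖anticonformalPart 0‖ = 0 := by
      rw [← opNorm_eq_norm_add_norm]
      simp [opNorm]
    rw [h, burkSupport_zero hp]
    simp [Burk]
  · have habs : |1 - 2 / p| = 1 - 2 / p := by
      refine abs_of_nonneg (sub_nonneg.mpr ?_)
      rw [div_le_one (by linarith)]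
      exact hp.le
    rw [Burk, if_neg hA, opNorm_eq_norm_add_norm, det_eq_sq_norm_sub_sq_norm,
      burkSupport_add hp.le (norm_conformalPart_add_norm_anticonformalPart_pos hA)]
    push_cast
    rw [habs]

lemma Burk_two_two (A : Matrix (Fin 2) (Fin 2) ℝ) : Burk 2 2 A = A.det := by
  by_cases hA : A = 0
  · simp [Burk, hA]
  · simp [Burk, hA]

/-- For `p ≥ 2`, the positive part `B_p⁺ = max(B_p, 0)` of the
two-dimensional Burkholder integrand is polyconvex. -/
theorem stmt_11 (p : ℝ) (hp : 2 ≤ p) :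
    ∃ G : Matrix (Fin 2) (Fin 2) ℝ × ℝ → ℝ,
      ConvexOn ℝ Set.univ G ∧
      ∀ A : Matrix (Fin 2) (Fin 2) ℝ, max (Burk 2 p A) 0 = G (A, A.det) := by
  rcases hp.eq_or_lt with rfl | hp
  · refine ⟨fun x ↦ max x.2 0, ?_, fun A ↦ by rw [Burk_two_two]⟩
    exact ((LinearMap.snd ℝ _ ℝ).convexOn convex_univ).sup (convexOn_const 0 convex_univ)
  · exact ⟨_, convexOn_burkEnvelope hp, max_Burk_zero_eq_burkEnvelope hp⟩
end

section
/- For every p > 3, the integrand B_p⁺ = max{B_p, 0} : ℝ^{3×3} → [0,∞) is not polyconvex at A₀ = diag(1,0,0): there is no convex function G : ℝ^{3×3} × ℝ^{3×3} × ℝ → ℝ such that G(A₀, cof A₀, det A₀) = B_p⁺(A₀) and G(A, cof A, det A) ≤ B_p⁺(A) for all A ∈ ℝ^{3×3}. In particular B_p⁺ : ℝ^{3×3} → [0,∞) is not polyconvex. -/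
open Matrix MeasureTheory Set

open scoped Matrix.Norms.L2Operator in
/-- The operator norm of a diagonal matrix is the sup norm of its diagonal. -/
lemma opNorm_diagonal {n : ℕ} (v : Fin n → ℝ) : opNorm (Matrix.diagonal v) = ‖v‖ :=
  (Matrix.l2_opNorm_def _).symm.trans (Matrix.l2_opNorm_diagonal v)

lemma burk_diagonal {p r x y z : ℝ} (hr : 0 < r) (hv : ‖![x, y, z]‖ = r) :
    Burk 3 p (Matrix.diagonal ![x, y, z]) =
      (|1 - 3 / p| * r ^ 3 + x * y * z) * r ^ (p - 3) := by
  have hne : Matrix.diagonal ![x, y, z] ≠ 0 := by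
    intro h
    rw [Matrix.diagonal_eq_zero.mp h, norm_zero] at hv
    exact hr.ne hv
  rw [Burk, if_neg hne, opNorm_diagonal, hv]
  simp [Matrix.det_diagonal, Fin.prod_univ_three]

lemma adjugate_diagonal_fin_three (x y z : ℝ) :
    Matrix.adjugate (Matrix.diagonal ![x, y, z]) =
      Matrix.diagonal ![y * z, x * z, x * y] := by
  ext i j
  fin_cases i <;> fin_cases j <;> simp [Matrix.diagonal, Matrix.adjugate_fin_three]

/-- A real convex function on a finite-dimensional space has a subgradient at every point. -/
lemma ConvexOn.exists_subgradient {E : Type*} [NormedAddCommGroup E] [NormedSpace ℝ E]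
    [FiniteDimensional ℝ E] {φ : E → ℝ} (hφ : ConvexOn ℝ Set.univ φ) (x : E) :
    ∃ l : E →ₗ[ℝ] ℝ, ∀ y, φ x + l (y - x) ≤ φ y := by
  have hcont : Continuous φ := hφ.locallyLipschitz.continuous
  have hopen : IsOpen {q : E × ℝ | q.1 ∈ Set.univ ∧ φ q.1 < q.2} := by
    simpa using isOpen_lt (hcont.comp continuous_fst) continuous_snd
  obtain ⟨f, hf⟩ := geometric_hahn_banach_point_open (x := (x, φ x))
    hφ.convex_strict_epigraph hopen (by simp)
  have hdec : ∀ (y : E) (t : ℝ), f (y, t) = f (y, 0) + t * f (0, 1) := by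
    intro y t
    have : ((y, t) : E × ℝ) = (y, 0) + t • (0, 1) := by simp
    rw [this, map_add, map_smul, smul_eq_mul]
  set k := f (0, 1) with hk
  have hkpos : 0 < k := by
    have := hf (x, φ x + 1) (by simp)
    rw [hdec x (φ x), hdec x (φ x + 1)] at this
    linarith
  refine ⟨-(k⁻¹ • (f.toLinearMap ∘ₗ LinearMap.inl ℝ E ℝ)), fun y => ?_⟩
  have hsub : f (y - x, 0) = f (y, 0) - f (x, 0) := by
    rw [← map_sub]; simp
  have hle : φ x * k + f (x, 0) ≤ φ y * k + f (y, 0) := by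
    refine le_of_forall_pos_lt_add fun ε hε => ?_
    have := hf (y, φ y + ε / k) (by simp; positivity)
    rw [hdec x, hdec y, add_mul, div_mul_cancel₀ _ hkpos.ne'] at this
    linarith
  have hgoal : φ x - k⁻¹ * (f (y, 0) - f (x, 0)) ≤ φ y := by
    rw [sub_le_iff_le_add, ← sub_le_iff_le_add', inv_mul_eq_div, le_div_iff₀ hkpos]
    linarith
  simp only [LinearMap.neg_apply, LinearMap.smul_apply, LinearMap.comp_apply,
    LinearMap.inl_apply, ContinuousLinearMap.coe_coe, hsub, smul_eq_mul]
  linarith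

/-- The linear embedding of the span of `diag(1,0,0)` in each matrix slot. -/
noncomputable def minorsEmbedding :
    ℝ × ℝ × ℝ →ₗ[ℝ] Matrix (Fin 3) (Fin 3) ℝ × Matrix (Fin 3) (Fin 3) ℝ × ℝ :=
  LinearMap.prodMap (LinearMap.toSpanSingleton ℝ _ (Matrix.diagonal ![1, 0, 0]))
    (LinearMap.prodMap (LinearMap.toSpanSingleton ℝ _ (Matrix.diagonal ![1, 0, 0]))
      LinearMap.id)

lemma smul_diagonal_one_zero_zero (x : ℝ) :
    x • (Matrix.diagonal ![1, 0, 0] : Matrix (Fin 3) (Fin 3) ℝ) =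
      Matrix.diagonal ![x, 0, 0] := by
  rw [← Matrix.diagonal_smul]; simp

lemma minorsEmbedding_apply (x w v : ℝ) :
    minorsEmbedding (x, w, v) = (Matrix.diagonal ![x, 0, 0], Matrix.diagonal ![w, 0, 0], v) := by
  simp [minorsEmbedding, smul_diagonal_one_zero_zero]

/-- Averaging `diag(x,y,z)` with `diag(x,-y,-z)` removes all minors other than
`x`, `yz` and `xyz`. -/
lemma le_of_polyconvex_minorant {p : ℝ}
    {G : Matrix (Fin 3) (Fin 3) ℝ × Matrix (Fin 3) (Fin 3) ℝ × ℝ → ℝ}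
    (hG : ConvexOn ℝ Set.univ G)
    (hle : ∀ A : Matrix (Fin 3) (Fin 3) ℝ,
      G (A, (Matrix.adjugate A)ᵀ, A.det) ≤ max (Burk 3 p A) 0)
    {r x y z : ℝ} (hr : 0 < r) (hv : ‖![x, y, z]‖ = r) :
    G (minorsEmbedding (x, y * z, x * y * z)) ≤
      max ((|1 - 3 / p| * r ^ 3 + x * y * z) * r ^ (p - 3)) 0 := by
  have hv' : ‖![x, -y, -z]‖ = r := by
    rw [← hv]; simp [Pi.norm_def, Fin.univ_succ]
  have h1 := hle (Matrix.diagonal ![x, y, z])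
  have h2 := hle (Matrix.diagonal ![x, -y, -z])
  rw [burk_diagonal hr hv] at h1
  rw [burk_diagonal hr hv'] at h2
  rw [show x * -y * -z = x * y * z by ring] at h2
  have hc := hG.2 (Set.mem_univ (Matrix.diagonal ![x, y, z],
      (Matrix.adjugate (Matrix.diagonal ![x, y, z]))ᵀ, (Matrix.diagonal ![x, y, z]).det))
    (Set.mem_univ (Matrix.diagonal ![x, -y, -z],
      (Matrix.adjugate (Matrix.diagonal ![x, -y, -z]))ᵀ, (Matrix.diagonal ![x, -y, -z]).det))
    (by norm_num : (0 : ℝ) ≤ 1 / 2) (by norm_num : (0 : ℝ) ≤ 1 / 2) (by norm_num)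
  have hmid : minorsEmbedding (x, y * z, x * y * z) =
      (1 / 2 : ℝ) • (Matrix.diagonal ![x, y, z],
        (Matrix.adjugate (Matrix.diagonal ![x, y, z]))ᵀ, (Matrix.diagonal ![x, y, z]).det) +
      (1 / 2 : ℝ) • (Matrix.diagonal ![x, -y, -z],
        (Matrix.adjugate (Matrix.diagonal ![x, -y, -z]))ᵀ,
        (Matrix.diagonal ![x, -y, -z]).det) := by
    rw [minorsEmbedding_apply, adjugate_diagonal_fin_three, adjugate_diagonal_fin_three]
    simp only [Matrix.diagonal_transpose, Matrix.det_diagonal, Fin.prod_univ_three,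
      Prod.smul_mk, Prod.mk_add_mk, ← Matrix.diagonal_smul, Matrix.diagonal_add]
    refine Prod.ext ?_ (Prod.ext ?_ ?_)
    · refine congrArg Matrix.diagonal (funext fun i => ?_)
      fin_cases i <;> norm_num; ring
    · refine congrArg Matrix.diagonal (funext fun i => ?_)
      fin_cases i <;> norm_num; ring
    · simp; ring
  rw [hmid]
  refine hc.trans ?_
  simp only [smul_eq_mul]
  linarith

lemma norm_vec_three_eq {r x y z : ℝ} (hr : 0 ≤ r) (hx : |x| ≤ r) (hy : |y| ≤ r) (hz : |z| ≤ r)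
    (h : |x| = r ∨ |y| = r) : ‖![x, y, z]‖ = r := by
  refine le_antisymm ((pi_norm_le_iff_of_nonneg hr).2 fun i => ?_) ?_
  · fin_cases i <;> simpa
  · rcases h with h | h
    · simpa [h] using norm_le_pi_norm ![x, y, z] 0
    · simpa [h] using norm_le_pi_norm ![x, y, z] 1

/-- A differentiable function on a neighbourhood of `1` with a local maximum there has zero
derivative, phrased for functions bounded on the positive half-line. -/
lemma deriv_eq_zero_of_nonpos_of_pos {f : ℝ → ℝ} {d : ℝ} (hd : HasDerivAt f d 1) (h1 : f 1 = 0)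
    (h : ∀ x, 0 < x → f x ≤ 0) : d = 0 := by
  refine IsLocalMax.hasDerivAt_eq_zero ?_ hd
  filter_upwards [lt_mem_nhds (zero_lt_one' ℝ)] with x hx
  rw [h1]; exact h x hx

/-- No affine function of `(x, w, xw)` touches from below, at `(1, 0)`, the restriction of
`B_p⁺` to diagonal matrices. -/
lemma no_affine_minorant {p a m N : ℝ} (hp : 3 < p)
    (H : ∀ r x y z : ℝ, 0 < r → ‖![x, y, z]‖ = r →
      (1 - 3 / p) + a * (x - 1) + m * (y * z) + N * (x * y * z) ≤
        max (((1 - 3 / p) * r ^ 3 + x * y * z) * r ^ (p - 3)) 0) : False := by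
  have hp0 : 0 < p := by linarith
  set c := 1 - 3 / p with hc
  have hcp : c * p = p - 3 := by rw [hc]; field_simp
  have hc0 : 0 < c := by rw [hc, sub_pos, div_lt_one hp0]; exact hp
  have hc1 : c < 1 := by rw [hc]; linarith [div_pos (zero_lt_three' ℝ) hp0]
  set s := √c with hs
  have hs0 : 0 ≤ s := Real.sqrt_nonneg c
  have hss : s * s = c := Real.mul_self_sqrt hc0.le
  have hs1 : s ≤ 1 := by exact Real.sqrt_le_one.mpr hc1.le
  have ha : a = c * p := by
    have hd : HasDerivAt (fun x : ℝ => c + a * (x - 1) - c * x ^ p) (a - c * p) 1 := by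
      have h := ((((hasDerivAt_id (1 : ℝ)).sub_const 1).const_mul a).const_add c).sub
        ((Real.hasDerivAt_rpow_const (p := p) (Or.inl (one_ne_zero' ℝ))).const_mul c)
      exact h.congr_deriv (by simp)
    have := deriv_eq_zero_of_nonpos_of_pos hd (by simp) fun x hx => by
      have h := H x x 0 0 hx (norm_vec_three_eq hx.le (abs_of_pos hx).le (by simpa using hx.le)
        (by simpa using hx.le) (Or.inl (abs_of_pos hx)))
      have hpow : x ^ 3 * x ^ (p - 3) = x ^ p := by
        rw [← Real.rpow_natCast, ← Real.rpow_add hx]; norm_num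
      simp only [mul_zero, add_zero, mul_assoc, hpow] at h
      rw [max_eq_left (by positivity)] at h
      linarith
    linarith
  have hmN : m + N = 1 := by
    have habs : |s| ≤ 1 := by rw [abs_of_nonneg hs0]; exact hs1
    have hpos := H 1 1 s s one_pos
      (norm_vec_three_eq zero_le_one (by simp) habs habs (Or.inl (by simp)))
    have hneg := H 1 1 s (-s) one_pos
      (norm_vec_three_eq zero_le_one (by simp) habs (by simpa using habs) (Or.inl (by simp)))
    simp only [Real.one_rpow, one_mul, mul_neg, hss] at hpos hneg
    rw [max_eq_left (by linarith)] at hpos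
    rw [max_eq_left (by linarith)] at hneg
    nlinarith
  have hcub : a = c * (2 * m + 3 * N) := by
    have hd : HasDerivAt (fun x : ℝ => c + a * (x - 1) - c * (m * x ^ 2 + N * x ^ 3))
        (a - c * (2 * m + 3 * N)) 1 := by
      have h := ((((hasDerivAt_id (1 : ℝ)).sub_const 1).const_mul a).const_add c).sub
        ((((hasDerivAt_pow 2 (1 : ℝ)).const_mul m).add
          ((hasDerivAt_pow 3 (1 : ℝ)).const_mul N)).const_mul c)
      exact h.congr_deriv (by push_cast; ring)
    have := deriv_eq_zero_of_nonpos_of_pos hd (by simp [hmN]) fun x hx => by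
      have habs : |s * x| ≤ x := by
        rw [abs_of_nonneg (by positivity)]; exact mul_le_of_le_one_left hx.le hs1
      have h := H x x (s * x) (-(s * x)) hx (norm_vec_three_eq hx.le (abs_of_pos hx).le habs
        (by simpa using habs) (Or.inl (abs_of_pos hx)))
      have e1 : s * x * -(s * x) = -(c * x ^ 2) := by rw [← hss]; ring
      have e2 : x * (s * x) * -(s * x) = -(c * x ^ 3) := by rw [← hss]; ring
      rw [e1, e2] at h
      rw [add_neg_cancel, zero_mul, max_self] at h
      linarith
    linarith
  have hpmN : p = 2 * m + 3 * N := mul_left_cancel₀ hc0.ne' (ha.symm.trans hcub)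
  have hN : N = p - 2 := by linarith
  have hm : m = 3 - p := by linarith
  obtain ⟨q, hq1, hq⟩ : ∃ q : ℝ, 1 < q ∧ 0 < -(p - 2) * q ^ 2 + 2 * q + (p - 1) := by
    have hi : 0 < 1 / p := by positivity
    refine ⟨1 + 1 / p, by linarith, ?_⟩
    have : -(p - 2) * (1 + 1 / p) ^ 2 + 2 * (1 + 1 / p) + (p - 1) =
        (p ^ 2 + 5 * p + 2) / p ^ 2 := by
      field_simp; ring
    rw [this]; positivity
  have hq0 : 0 < q := by linarith
  have hcq : |c * q| ≤ q := by
    rw [abs_of_pos (by positivity)]; exact mul_le_of_le_one_left hq0.le hc1.le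
  have h := H q (c * q) q (-q) hq0 (norm_vec_three_eq hq0.le hcq (abs_of_pos hq0).le
    (by rw [abs_neg, abs_of_pos hq0]) (Or.inr (abs_of_pos hq0)))
  have e : c * q ^ 3 + c * q * q * -q = 0 := by ring
  rw [e, zero_mul, max_self, ha, hcp, hm, hN] at h
  have hkey : p * (c + (p - 3) * (c * q - 1) + (3 - p) * (q * -q) +
      (p - 2) * (c * q * q * -q)) =
      (p - 3) * ((q - 1) * (-(p - 2) * q ^ 2 + 2 * q + (p - 1))) := by
    linear_combination (1 + (p - 3) * q - (p - 2) * q ^ 3) * hcp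
  have hpos : 0 < (p - 3) * ((q - 1) * (-(p - 2) * q ^ 2 + 2 * q + (p - 1))) :=
    mul_pos (by linarith) (mul_pos (by linarith) hq)
  rw [← hkey] at hpos
  exact absurd h (not_le.mpr (pos_of_mul_pos_right hpos hp0.le))

/-- For `p > 3`, the integrand `B_p⁺ = max(B_p, 0)` on `ℝ^{3×3}` is not
polyconvex at `A₀ = diag(1,0,0)`: there is no convex `G : ℝ^{3×3} × ℝ^{3×3} × ℝ → ℝ`
with `G(A₀, cof A₀, det A₀) = B_p⁺(A₀)` and `G(A, cof A, det A) ≤ B_p⁺(A)` for all `A`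
(here `cof A = (adjugate A)ᵀ` is the cofactor matrix). -/
theorem stmt_14 (p : ℝ) (hp : 3 < p) :
    ¬ ∃ G : Matrix (Fin 3) (Fin 3) ℝ × Matrix (Fin 3) (Fin 3) ℝ × ℝ → ℝ,
        ConvexOn ℝ Set.univ G ∧
        G (Matrix.diagonal ![1, 0, 0], (Matrix.adjugate (Matrix.diagonal ![1, 0, 0]))ᵀ,
            (Matrix.diagonal ![1, 0, 0]).det) = max (Burk 3 p (Matrix.diagonal ![1, 0, 0])) 0 ∧
        ∀ A : Matrix (Fin 3) (Fin 3) ℝ,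
          G (A, (Matrix.adjugate A)ᵀ, A.det) ≤ max (Burk 3 p A) 0 := by
  rintro ⟨G, hG, hG0, hle⟩
  have hc0 : 0 < 1 - 3 / p := by
    rw [sub_pos, div_lt_one (by linarith)]; exact hp
  have hbase : G (minorsEmbedding (1, 0, 0)) = 1 - 3 / p := by
    rw [burk_diagonal one_pos (norm_vec_three_eq zero_le_one (by simp) (by simp) (by simp)
      (Or.inl (by simp))), adjugate_diagonal_fin_three] at hG0
    simp only [Matrix.det_diagonal, Fin.prod_univ_three, Matrix.diagonal_transpose] at hG0
    rw [minorsEmbedding_apply]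
    simpa [abs_of_pos hc0, hc0.le] using hG0
  obtain ⟨l, hl⟩ := (hG.comp_linearMap minorsEmbedding).exists_subgradient (1, 0, 0)
  refine no_affine_minorant (a := l (1, 0, 0)) (m := l (0, 1, 0)) (N := l (0, 0, 1)) hp ?_
  intro r x y z hr hv
  have h := (hl (x, y * z, x * y * z)).trans (le_of_polyconvex_minorant hG hle hr hv)
  rw [abs_of_pos hc0, Function.comp_apply, hbase] at h
  have hdec : ((x, y * z, x * y * z) : ℝ × ℝ × ℝ) - (1, 0, 0) =
      (x - 1) • (1, 0, 0) + (y * z) • (0, 1, 0) + (x * y * z) • (0, 0, 1) := by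
    simp
  rw [hdec] at h
  simp only [map_add, map_smul, smul_eq_mul] at h
  linarith
end

section
/- For every p > 2, the Burkholder integrand B_p : ℝ^{2×2} → ℝ is polyconvex at no point: for every A₀ ∈ ℝ^{2×2} there is no convex function G : ℝ^{2×2} × ℝ → ℝ with G(A₀, det A₀) = B_p(A₀) and G(A, det A) ≤ B_p(A) for all A ∈ ℝ^{2×2}. -/
open Matrix MeasureTheory Set

lemma opNorm_diagonal_neg (t : ℝ) (ht : 0 ≤ t) (A : Matrix (Fin 2) (Fin 2) ℝ)
    (hA : A = !![t, 0; 0, -t] ∨ A = !![-t, 0; 0, t]) : opNorm A = t := by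
  unfold opNorm
  refine ContinuousLinearMap.homothety_norm _ fun x => ?_
  rw [← sq_eq_sq₀ (norm_nonneg _) (mul_nonneg ht (norm_nonneg _)), mul_pow,
    EuclideanSpace.norm_sq_eq, EuclideanSpace.norm_sq_eq]
  rcases hA with rfl | rfl <;>
    simp [Matrix.toLpLin_apply, dotProduct, Fin.sum_univ_two] <;> ring

lemma burk_diagonal_neg (p t : ℝ) (ht : 0 < t) (A : Matrix (Fin 2) (Fin 2) ℝ)
    (hA : A = !![t, 0; 0, -t] ∨ A = !![-t, 0; 0, t]) :
    Burk 2 p A = -((1 - |1 - 2 / p|) * t ^ 2 * t ^ (p - 2)) := by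
  have h0 : A ≠ 0 := by
    rintro rfl
    have := opNorm_diagonal_neg t ht.le 0 hA
    simp [opNorm] at this
    exact ht.ne this
  have hdet : A.det = -t ^ 2 := by
    rcases hA with rfl | rfl <;> simp [Matrix.det_fin_two] <;> ring
  rw [Burk, if_neg h0, opNorm_diagonal_neg t ht.le A hA, hdet]
  push_cast
  ring

/-- No convex function of `(A, det A)` lies below the Burkholder integrand: along anticonformal
matrices the integrand tends to `-∞` at a rate of order `p > 2`. -/
lemma not_convex_le_burk (p : ℝ) (hp : 2 < p) (G : Matrix (Fin 2) (Fin 2) ℝ × ℝ → ℝ)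
    (hG : ConvexOn ℝ Set.univ G)
    (hle : ∀ A : Matrix (Fin 2) (Fin 2) ℝ, G (A, A.det) ≤ Burk 2 p A) : False := by
  have hc : 0 < 1 - |1 - 2 / p| := by
    have h1 : 0 < 2 / p := by positivity
    have h2 : 2 / p < 1 := by rw [div_lt_one (by linarith)]; exact hp
    rw [abs_of_pos (by linarith)]
    linarith
  set c := 1 - |1 - 2 / p|
  set K := |G (0, 0)| + |G (0, 1)|
  have hlim : Filter.Tendsto (fun t : ℝ => t ^ (p - 2)) Filter.atTop Filter.atTop :=
    tendsto_rpow_atTop (by linarith)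
  obtain ⟨t, htK, ht1⟩ :=
    ((hlim.eventually_gt_atTop (2 * K / c)).and (Filter.eventually_ge_atTop 1)).exists
  have ht : 0 < t := by linarith
  have hmid : G (0, -t ^ 2) ≤ -(c * t ^ 2 * t ^ (p - 2)) := by
    have h1 := hle !![t, 0; 0, -t]
    have h2 := hle !![-t, 0; 0, t]
    rw [burk_diagonal_neg p t ht _ (Or.inl rfl)] at h1
    rw [burk_diagonal_neg p t ht _ (Or.inr rfl)] at h2
    have h := hG.2 (Set.mem_univ (!![t, 0; 0, -t], (!![t, 0; 0, -t]).det))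
      (Set.mem_univ (!![-t, 0; 0, t], (!![-t, 0; 0, t]).det))
      (by norm_num : (0 : ℝ) ≤ 1 / 2) (by norm_num : (0 : ℝ) ≤ 1 / 2) (by norm_num)
    have he : (1 / 2 : ℝ) • (!![t, 0; 0, -t], (!![t, 0; 0, -t]).det)
        + (1 / 2 : ℝ) • (!![-t, 0; 0, t], (!![-t, 0; 0, t]).det)
        = ((0 : Matrix (Fin 2) (Fin 2) ℝ), -t ^ 2) := by
      ext i j
      · fin_cases i <;> fin_cases j <;> simp
      · simp [Matrix.det_fin_two]
        ring
    rw [he] at h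
    simp only [smul_eq_mul] at h
    linarith
  have hconv : (1 + t ^ 2) * G (0, 0) ≤ t ^ 2 * G (0, 1) + G (0, -t ^ 2) := by
    have hpos : 0 < 1 + t ^ 2 := by positivity
    have h := hG.2 (Set.mem_univ ((0 : Matrix (Fin 2) (Fin 2) ℝ), (1 : ℝ)))
      (Set.mem_univ ((0 : Matrix (Fin 2) (Fin 2) ℝ), -t ^ 2))
      (by positivity : (0 : ℝ) ≤ t ^ 2 / (1 + t ^ 2))
      (by positivity : (0 : ℝ) ≤ 1 / (1 + t ^ 2)) (by field_simp; ring)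
    have he : (t ^ 2 / (1 + t ^ 2)) • ((0 : Matrix (Fin 2) (Fin 2) ℝ), (1 : ℝ))
        + (1 / (1 + t ^ 2)) • ((0 : Matrix (Fin 2) (Fin 2) ℝ), -t ^ 2) = (0, 0) := by
      ext i j
      · simp
      · simp only [Prod.snd_add, Prod.smul_snd, smul_eq_mul]
        ring
    rw [he] at h
    simp only [smul_eq_mul] at h
    have h' := mul_le_mul_of_nonneg_left h hpos.le
    field_simp at h'
    linarith
  rw [div_lt_iff₀ hc] at htK
  have ht2 : 1 ≤ t ^ 2 := one_le_pow₀ ht1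
  have hbig : t ^ 2 * (2 * K) < c * t ^ 2 * t ^ (p - 2) := by
    have := mul_lt_mul_of_pos_left htK (by positivity : 0 < t ^ 2)
    linarith
  have h0 : (1 + t ^ 2) * -|G (0, 0)| ≤ (1 + t ^ 2) * G (0, 0) :=
    mul_le_mul_of_nonneg_left (neg_abs_le _) (by positivity)
  have h1 : t ^ 2 * G (0, 1) ≤ t ^ 2 * |G (0, 1)| :=
    mul_le_mul_of_nonneg_left (le_abs_self _) (by positivity)
  nlinarith [abs_nonneg (G (0, 0)), abs_nonneg (G (0, 1)),
    mul_nonneg (sub_nonneg.2 ht2) (abs_nonneg (G (0, 0))),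
    mul_nonneg (sq_nonneg t) (abs_nonneg (G (0, 1)))]


/-- For `p > 2`, the Burkholder integrand `B_p : ℝ^{2×2} → ℝ` is
polyconvex at no point: for every `A₀` there is no convex `G : ℝ^{2×2} × ℝ → ℝ` with
`G(A₀, det A₀) = B_p(A₀)` and `G(A, det A) ≤ B_p(A)` for all `A`. -/
theorem stmt_15 (p : ℝ) (hp : 2 < p) (A₀ : Matrix (Fin 2) (Fin 2) ℝ) :
    ¬ ∃ G : Matrix (Fin 2) (Fin 2) ℝ × ℝ → ℝ,
        ConvexOn ℝ Set.univ G ∧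
        G (A₀, A₀.det) = Burk 2 p A₀ ∧
        ∀ A : Matrix (Fin 2) (Fin 2) ℝ, G (A, A.det) ≤ Burk 2 p A := by
  rintro ⟨G, hG, -, hle⟩
  exact not_convex_le_burk p hp G hG hle
end

section
/- The integrand B_♯(A) = ½(|A|² + (det A)·log(|A|²)), defined on the set ℝ^{2×2}_+ of 2×2 matrices with positive determinant, is polyconvex: there exists a convex function G : ℝ^{2×2} × (0,∞) → ℝ such that B_♯(A) = G(A, det A) for every A ∈ ℝ^{2×2} with det A > 0. -/
open Matrix MeasureTheory Set

/-- Twice the norm of the anticonformal part of `A`; it equals `σ₁ - σ₂` when `0 ≤ det A`. -/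
noncomputable def anticonformalNorm (A : Matrix (Fin 2) (Fin 2) ℝ) : ℝ :=
  ‖(⟨A 0 0 - A 1 1, A 0 1 + A 1 0⟩ : ℂ)‖

/-- Twice the norm of the conformal part of `A`; it equals `σ₁ + σ₂` when `0 ≤ det A`. -/
noncomputable def conformalNorm (A : Matrix (Fin 2) (Fin 2) ℝ) : ℝ :=
  ‖(⟨A 0 0 + A 1 1, A 0 1 - A 1 0⟩ : ℂ)‖

theorem anticonformalNorm_sq (A : Matrix (Fin 2) (Fin 2) ℝ) :
    anticonformalNorm A ^ 2 = (A 0 0 - A 1 1) ^ 2 + (A 0 1 + A 1 0) ^ 2 := by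
  rw [anticonformalNorm, Complex.sq_norm, Complex.normSq_mk]
  ring

theorem conformalNorm_sq (A : Matrix (Fin 2) (Fin 2) ℝ) :
    conformalNorm A ^ 2 = (A 0 0 + A 1 1) ^ 2 + (A 0 1 - A 1 0) ^ 2 := by
  rw [conformalNorm, Complex.sq_norm, Complex.normSq_mk]
  ring

theorem convexOn_anticonformalNorm : ConvexOn ℝ Set.univ anticonformalNorm := by
  refine ⟨convex_univ, fun A _ B _ a b ha hb _ => ?_⟩
  have h : (⟨(a • A + b • B) 0 0 - (a • A + b • B) 1 1,
      (a • A + b • B) 0 1 + (a • A + b • B) 1 0⟩ : ℂ) =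
      a • (⟨A 0 0 - A 1 1, A 0 1 + A 1 0⟩ : ℂ) + b • (⟨B 0 0 - B 1 1, B 0 1 + B 1 0⟩ : ℂ) := by
    apply Complex.ext <;> simp <;> ring
  unfold anticonformalNorm
  rw [h]
  refine (norm_add_le _ _).trans_eq ?_
  rw [norm_smul, norm_smul, Real.norm_of_nonneg ha, Real.norm_of_nonneg hb, smul_eq_mul,
    smul_eq_mul]

theorem opNorm_eq_of_fin_two (A : Matrix (Fin 2) (Fin 2) ℝ) :
    opNorm A = (conformalNorm A + anticonformalNorm A) / 2 := by
  have hu := conformalNorm_sq A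
  have hw := anticonformalNorm_sq A
  have hu0 : 0 ≤ conformalNorm A := norm_nonneg _
  have hw0 : 0 ≤ anticonformalNorm A := norm_nonneg _
  set u := conformalNorm A
  set w := anticonformalNorm A
  set S := (u + w) / 2 with hS
  have hS0 : 0 ≤ S := by positivity
  set P := S ^ 2 - (A 0 0 ^ 2 + A 1 0 ^ 2) with hP
  set R := S ^ 2 - (A 0 1 ^ 2 + A 1 1 ^ 2) with hR
  set Q := A 0 0 * A 0 1 + A 1 0 * A 1 1 with hQ
  have htr : P + R = u * w := by
    rw [hP, hR, hS]
    linear_combination hu / 2 + hw / 2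
  have hdet : P * R = Q ^ 2 := by
    have h1 : (P - R) ^ 2 + 4 * Q ^ 2 = u ^ 2 * w ^ 2 := by
      rw [hu, hw, hP, hR, hQ]; ring
    have h2 : (P + R) ^ 2 = u ^ 2 * w ^ 2 := by rw [htr]; ring
    linear_combination (h2 - h1) / 4
  have hsq (v : EuclideanSpace ℝ (Fin 2)) :
      S ^ 2 * ‖v‖ ^ 2 - ‖Matrix.toEuclideanLin A v‖ ^ 2 =
        P * v 0 ^ 2 - 2 * Q * v 0 * v 1 + R * v 1 ^ 2 := by
    simp only [EuclideanSpace.real_norm_sq_eq, Fin.sum_univ_two, Matrix.toLpLin_apply,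
      Matrix.mulVec, dotProduct]
    rw [hP, hR, hQ]
    ring
  have htr0 : 0 ≤ P + R := htr ▸ mul_nonneg hu0 hw0
  refine le_antisymm (ContinuousLinearMap.opNorm_le_bound _ hS0 fun v => ?_) ?_
  · refine abs_le_of_sq_le_sq' ?_ (by positivity) |>.2
    have key : 0 ≤ P * v 0 ^ 2 - 2 * Q * v 0 * v 1 + R * v 1 ^ 2 := by
      rcases htr0.eq_or_lt with h0 | hpos
      · have hP0 : P = 0 := by nlinarith [sq_nonneg Q, sq_nonneg P]
        have hR0 : R = 0 := by linarith
        have hQ0 : Q = 0 := by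
          rw [hP0, zero_mul] at hdet
          exact pow_eq_zero_iff two_ne_zero |>.1 hdet.symm
        simp [hP0, hR0, hQ0]
      · refine nonneg_of_mul_nonneg_right (a := P + R) ?_ hpos
        have : (P + R) * (P * v 0 ^ 2 - 2 * Q * v 0 * v 1 + R * v 1 ^ 2) =
            (P * v 0 - Q * v 1) ^ 2 + (R * v 1 - Q * v 0) ^ 2 := by
          linear_combination (v 0 ^ 2 + v 1 ^ 2) * hdet
        rw [this]; positivity
    have := hsq v
    rw [LinearMap.coe_toContinuousLinearMap', mul_pow]
    linarith
  · obtain ⟨v, hv, hv0⟩ : ∃ v : EuclideanSpace ℝ (Fin 2), v ≠ 0 ∧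
        P * v 0 ^ 2 - 2 * Q * v 0 * v 1 + R * v 1 ^ 2 = 0 := by
      by_cases hPQ : P = 0
      · refine ⟨!₂[1, 0], fun h => ?_, by simp [hPQ]⟩
        simpa using congrArg (fun x : EuclideanSpace ℝ (Fin 2) => x 0) h
      · refine ⟨!₂[Q, P], fun h => hPQ ?_, ?_⟩
        · simpa using congrArg (fun x : EuclideanSpace ℝ (Fin 2) => x 1) h
        · simp
          linear_combination P * hdet
    have h1 := hsq v
    rw [hv0, sub_eq_zero, ← mul_pow] at h1
    have h2 : S * ‖v‖ = ‖Matrix.toEuclideanLin A v‖ :=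
      (sq_eq_sq₀ (by positivity) (norm_nonneg _)).1 h1
    refine le_of_mul_le_mul_right (h2.trans_le ?_) (norm_pos_iff.2 hv)
    exact ContinuousLinearMap.le_opNorm
      (LinearMap.toContinuousLinearMap (Matrix.toEuclideanLin A)) v

theorem opNorm_sq_eq_of_fin_two (A : Matrix (Fin 2) (Fin 2) ℝ) :
    opNorm A ^ 2 = opNorm A * anticonformalNorm A + A.det := by
  rw [opNorm_eq_of_fin_two, Matrix.det_fin_two]
  linear_combination (conformalNorm_sq A - anticonformalNorm_sq A) / 4

/-- The family of convex functions of `(A, δ)`, indexed by `r > 0`, whose supremum extends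
`B_♯`. -/
noncomputable def burkholderMinorant (r : ℝ) (x : Matrix (Fin 2) (Fin 2) ℝ × ℝ) : ℝ :=
  r * anticonformalNorm x.1 - r ^ 2 / 2 + x.2 * (Real.log r + 1)

theorem convexOn_burkholderMinorant {r : ℝ} (hr : 0 ≤ r) :
    ConvexOn ℝ Set.univ (burkholderMinorant r) := by
  refine ⟨convex_univ, fun x _ y _ a b ha hb hab => ?_⟩
  have h := mul_le_mul_of_nonneg_left
    (convexOn_anticonformalNorm.2 (mem_univ x.1) (mem_univ y.1) ha hb hab) hr
  simp only [burkholderMinorant, Prod.fst_add, Prod.snd_add, Prod.smul_fst, Prod.smul_snd,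
    smul_eq_mul] at h ⊢
  obtain rfl : b = 1 - a := by linarith
  linarith

theorem bddAbove_range_burkholderMinorant {x : Matrix (Fin 2) (Fin 2) ℝ × ℝ} (hx : 0 ≤ x.2) :
    BddAbove (range fun r : Ioi (0 : ℝ) => burkholderMinorant r x) := by
  refine ⟨(anticonformalNorm x.1 + x.2) ^ 2 / 2, ?_⟩
  rintro _ ⟨⟨r, hr⟩, rfl⟩
  have hlog := mul_le_mul_of_nonneg_left (Real.log_le_sub_one_of_pos hr) hx
  simp only [burkholderMinorant]
  nlinarith [sq_nonneg (anticonformalNorm x.1 + x.2 - r)]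

theorem convexOn_iSup_burkholderMinorant :
    ConvexOn ℝ ((Set.univ : Set (Matrix (Fin 2) (Fin 2) ℝ)) ×ˢ Set.Ioi (0 : ℝ))
      fun x => ⨆ r : Ioi (0 : ℝ), burkholderMinorant r x := by
  refine ⟨convex_univ.prod (convex_Ioi 0), fun x hx y hy a b ha hb hab => ?_⟩
  have : Nonempty (Ioi (0 : ℝ)) := ⟨⟨1, mem_Ioi.2 one_pos⟩⟩
  refine ciSup_le fun r => ((convexOn_burkholderMinorant (le_of_lt r.2)).2
    (mem_univ x) (mem_univ y) ha hb hab).trans ?_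
  exact add_le_add
    (smul_le_smul_of_nonneg_left
      (le_ciSup (bddAbove_range_burkholderMinorant (le_of_lt hx.2)) r) ha)
    (smul_le_smul_of_nonneg_left
      (le_ciSup (bddAbove_range_burkholderMinorant (le_of_lt hy.2)) r) hb)

theorem iSup_burkholderMinorant_det {A : Matrix (Fin 2) (Fin 2) ℝ} (hA : 0 < A.det) :
    ⨆ r : Ioi (0 : ℝ), burkholderMinorant r (A, A.det) =
      (opNorm A ^ 2 + A.det * Real.log (opNorm A ^ 2)) / 2 := by
  have hs := opNorm_sq_eq_of_fin_two A
  have hpos : 0 < opNorm A := by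
    refine lt_of_le_of_ne (norm_nonneg _) fun h => hA.ne' ?_
    rw [← h] at hs
    linarith
  have hlog : Real.log (opNorm A ^ 2) = 2 * Real.log (opNorm A) := by
    rw [Real.log_pow]; norm_num
  have : Nonempty (Ioi (0 : ℝ)) := ⟨⟨1, mem_Ioi.2 one_pos⟩⟩
  rw [hlog]
  refine le_antisymm (ciSup_le ?_) ?_
  · rintro ⟨r, hr⟩
    rw [mem_Ioi] at hr
    have h1 : Real.log r ≤ r / opNorm A - 1 + Real.log (opNorm A) := by
      have := Real.log_le_sub_one_of_pos (div_pos hr hpos)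
      rw [Real.log_div hr.ne' hpos.ne'] at this
      linarith
    have h2 := mul_le_mul_of_nonneg_left h1 hA.le
    have h3 : A.det * (r / opNorm A) = r * (opNorm A - anticonformalNorm A) := by
      field_simp
      linear_combination -hs
    simp only [burkholderMinorant]
    nlinarith [sq_nonneg (r - opNorm A)]
  · refine le_trans (le_of_eq ?_)
      (le_ciSup (bddAbove_range_burkholderMinorant (x := (A, A.det)) hA.le) ⟨opNorm A, hpos⟩)
    simp only [burkholderMinorant]
    linear_combination hs

/-- The integrand `B_♯(A) = (|A|² + (det A)·log(|A|²))/2` is polyconvex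
on `ℝ^{2×2}_+`: there is a convex `G : ℝ^{2×2} × (0,∞) → ℝ` with `B_♯(A) = G(A, det A)`
whenever `det A > 0`. -/
theorem stmt_17 :
    ∃ G : Matrix (Fin 2) (Fin 2) ℝ × ℝ → ℝ,
      ConvexOn ℝ ((Set.univ : Set (Matrix (Fin 2) (Fin 2) ℝ)) ×ˢ Set.Ioi (0 : ℝ)) G ∧
      ∀ A : Matrix (Fin 2) (Fin 2) ℝ, 0 < A.det →
        (opNorm A ^ 2 + A.det * Real.log (opNorm A ^ 2)) / 2 = G (A, A.det) := by
  exact ⟨_, convexOn_iSup_burkholderMinorant,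
    fun _ hA => (iSup_burkholderMinorant_det hA).symm⟩
end

section
/- Let F : ℝ^{2×2} → ℝ be continuous, rank-one convex, isotropic and positively p-homogeneous for some p > 0, and suppose F is not identically zero. Then F(Id) > 0 or F(Īd) > 0, where Īd = diag(1,−1). -/
open Matrix MeasureTheory Set

/-- The rotation of the plane by the angle `θ`. -/
noncomputable def planeRotation (θ : ℝ) : Matrix (Fin 2) (Fin 2) ℝ :=
  !![Real.cos θ, -Real.sin θ; Real.sin θ, Real.cos θ]

theorem planeRotation_transpose_mul_self (θ : ℝ) :
    (planeRotation θ)ᵀ * planeRotation θ = 1 := by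
  ext i j
  fin_cases i <;> fin_cases j <;>
    simp [planeRotation, Matrix.mul_apply, Fin.sum_univ_two] <;>
    nlinarith [Real.sin_sq_add_cos_sq θ]

theorem det_planeRotation (θ : ℝ) : (planeRotation θ).det = 1 := by
  simp only [planeRotation, Matrix.det_fin_two_of]
  nlinarith [Real.sin_sq_add_cos_sq θ]

/-- Singular value decomposition of a real `2 × 2` matrix with rotations as orthogonal factors
and signed singular values. -/
theorem exists_eq_planeRotation_mul_diagonal_mul (A : Matrix (Fin 2) (Fin 2) ℝ) :
    ∃ θ φ x y : ℝ, A = planeRotation θ * Matrix.diagonal ![x, y] * planeRotation φ := by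
  let z : ℂ := ⟨(A 0 0 + A 1 1) / 2, (A 1 0 - A 0 1) / 2⟩
  let w : ℂ := ⟨(A 0 0 - A 1 1) / 2, (A 1 0 + A 0 1) / 2⟩
  obtain ⟨θ, φ, hz, hw⟩ : ∃ θ φ : ℝ, z.arg = θ + φ ∧ w.arg = θ - φ :=
    ⟨(z.arg + w.arg) / 2, (z.arg - w.arg) / 2, by ring, by ring⟩
  have h₁ : ‖z‖ * Real.cos (θ + φ) = (A 0 0 + A 1 1) / 2 := hz ▸ Complex.norm_mul_cos_arg z
  have h₂ : ‖z‖ * Real.sin (θ + φ) = (A 1 0 - A 0 1) / 2 := hz ▸ Complex.norm_mul_sin_arg z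
  have h₃ : ‖w‖ * Real.cos (θ - φ) = (A 0 0 - A 1 1) / 2 := hw ▸ Complex.norm_mul_cos_arg w
  have h₄ : ‖w‖ * Real.sin (θ - φ) = (A 1 0 + A 0 1) / 2 := hw ▸ Complex.norm_mul_sin_arg w
  rw [Real.cos_add] at h₁
  rw [Real.sin_add] at h₂
  rw [Real.cos_sub] at h₃
  rw [Real.sin_sub] at h₄
  refine ⟨θ, φ, ‖z‖ + ‖w‖, ‖z‖ - ‖w‖, ?_⟩
  ext i j
  fin_cases i <;> fin_cases j <;>
    simp [planeRotation, Matrix.mul_apply, Matrix.vecMul, dotProduct, Fin.sum_univ_two] <;>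
    linarith

theorem Isotropic.apply_planeRotation {F : Matrix (Fin 2) (Fin 2) ℝ → ℝ} (hF : Isotropic F)
    (A : Matrix (Fin 2) (Fin 2) ℝ) (θ φ : ℝ) :
    F (planeRotation θ * A * planeRotation φ) = F A :=
  hF A _ _ (planeRotation_transpose_mul_self θ) (det_planeRotation θ)
    (planeRotation_transpose_mul_self φ) (det_planeRotation φ)

theorem Isotropic.apply_neg {F : Matrix (Fin 2) (Fin 2) ℝ → ℝ} (hF : Isotropic F)
    (A : Matrix (Fin 2) (Fin 2) ℝ) : F (-A) = F A := by
  rw [← hF.apply_planeRotation A Real.pi 0]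
  congr 1
  ext i j
  fin_cases i <;> fin_cases j <;>
    simp [planeRotation, Matrix.mul_apply, Matrix.vecMul, dotProduct, Fin.sum_univ_two]

theorem Isotropic.apply_diagonal_swap {F : Matrix (Fin 2) (Fin 2) ℝ → ℝ} (hF : Isotropic F)
    (x y : ℝ) : F (Matrix.diagonal ![y, x]) = F (Matrix.diagonal ![x, y]) := by
  rw [← hF.apply_planeRotation (Matrix.diagonal ![x, y]) (Real.pi / 2) (-(Real.pi / 2))]
  congr 1
  ext i j
  fin_cases i <;> fin_cases j <;>
    simp [planeRotation, Matrix.mul_apply, Matrix.vecMul, dotProduct, Fin.sum_univ_two]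

theorem PosHomogeneous.apply_zero {n : ℕ} {p : ℝ} {F : Matrix (Fin n) (Fin n) ℝ → ℝ}
    (hF : PosHomogeneous p F) (hp : 0 < p) : F 0 = 0 := by
  have h := hF 0 2 two_pos
  rw [smul_zero] at h
  have h2 : (1 : ℝ) < 2 ^ p := Real.one_lt_rpow one_lt_two hp
  nlinarith

theorem RankOneConvex.convexOn_diagonal_right {F : Matrix (Fin 2) (Fin 2) ℝ → ℝ}
    (hF : RankOneConvex F) (x : ℝ) :
    ConvexOn ℝ Set.univ (fun y : ℝ => F (Matrix.diagonal ![x, y])) := by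
  have hrank : (Matrix.diagonal ![(0 : ℝ), 1]).rank = 1 := by
    rw [Matrix.rank_diagonal, Fintype.card_eq_one_iff]
    refine ⟨⟨1, by simp⟩, ?_⟩
    rintro ⟨i, hi⟩
    fin_cases i
    · exact (hi rfl).elim
    · rfl
  convert hF (Matrix.diagonal ![x, 0]) _ hrank using 3 with y
  ext i j
  fin_cases i <;> fin_cases j <;> simp

/-- A convex function that is nonpositive at `1` and `-1` is nonpositive on `[-1, 1]`. -/
theorem ConvexOn.nonpos_of_abs_le_one {g : ℝ → ℝ} (hg : ConvexOn ℝ Set.univ g)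
    (h₁ : g 1 ≤ 0) (h₂ : g (-1) ≤ 0) {y : ℝ} (hy : |y| ≤ 1) : g y ≤ 0 := by
  have hy' : y ∈ segment ℝ (-1 : ℝ) 1 := by
    rw [segment_eq_Icc (by norm_num)]
    exact abs_le.1 hy
  exact (hg.le_on_segment (Set.mem_univ _) (Set.mem_univ _) hy').trans (max_le h₂ h₁)

/-- A convex function on the real line is at most its symmetric averages at `0`. -/
theorem ConvexOn.two_mul_apply_zero_le {g : ℝ → ℝ} (hg : ConvexOn ℝ Set.univ g) (y : ℝ) :
    2 * g 0 ≤ g y + g (-y) := by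
  have h := hg.2 (Set.mem_univ y) (Set.mem_univ (-y))
    (show (0 : ℝ) ≤ 1 / 2 by norm_num) (show (0 : ℝ) ≤ 1 / 2 by norm_num) (by norm_num)
  simp only [smul_eq_mul] at h
  rw [show (1 / 2 : ℝ) * y + 1 / 2 * -y = 0 by ring] at h
  linarith

/-- If `F : ℝ^{2×2} → ℝ` is continuous, rank-one convex, isotropic and
positively `p`-homogeneous for some `p > 0`, and `F` is not identically zero, then
`F(Id) > 0` or `F(Īd) > 0`, where `Īd = diag(1,-1)`. -/
theorem stmt_19 (p : ℝ) (hp : 0 < p) (F : Matrix (Fin 2) (Fin 2) ℝ → ℝ)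
    (hFc : Continuous F) (hrc : RankOneConvex F) (hiso : Isotropic F)
    (hhom : PosHomogeneous p F) (hne : ∃ A, F A ≠ 0) :
    0 < F 1 ∨ 0 < F (Matrix.diagonal ![1, -1]) := by
  by_contra! hcon
  obtain ⟨hId, hIbar⟩ := hcon
  obtain ⟨A, hA⟩ := hne
  have hrank_one : 0 ≤ F (Matrix.diagonal ![1, 0]) := by
    have h := (hrc.convexOn_diagonal_right 0).two_mul_apply_zero_le 1
    have h_neg : Matrix.diagonal ![(0 : ℝ), -1] = -Matrix.diagonal ![0, 1] := by
      ext i j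
      fin_cases i <;> fin_cases j <;> simp
    have h_zero : Matrix.diagonal ![(0 : ℝ), 0] = 0 := by
      ext i j
      fin_cases i <;> fin_cases j <;> simp
    rw [h_neg, hiso.apply_neg, h_zero, hhom.apply_zero hp, hiso.apply_diagonal_swap] at h
    linarith
  have hone : ∀ y : ℝ, |y| ≤ 1 → F (Matrix.diagonal ![1, y]) = 0 := by
    intro y hy
    have hconv := hrc.convexOn_diagonal_right 1
    have h_one : Matrix.diagonal ![(1 : ℝ), 1] = 1 := by
      ext i j
      fin_cases i <;> fin_cases j <;> simp
    have hId' : F (Matrix.diagonal ![1, 1]) ≤ 0 := h_one ▸ hId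
    have h₁ := hconv.nonpos_of_abs_le_one hId' hIbar hy
    have h₂ := hconv.nonpos_of_abs_le_one hId' hIbar (y := -y) (by rwa [abs_neg])
    have h₃ := hconv.two_mul_apply_zero_le y
    linarith
  have hpos : ∀ x y : ℝ, 0 < x → |y| ≤ x → F (Matrix.diagonal ![x, y]) = 0 := by
    intro x y hx hy
    have h_eq : Matrix.diagonal ![x, y] = x • Matrix.diagonal ![1, y / x] := by
      ext i j
      fin_cases i <;> fin_cases j <;> simp
      field_simp
    rw [h_eq, hhom _ x hx, hone _ (by rwa [abs_div, abs_of_pos hx, div_le_one hx]), mul_zero]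
  have hle : ∀ x y : ℝ, |y| ≤ |x| → F (Matrix.diagonal ![x, y]) = 0 := by
    intro x y hxy
    rcases lt_trichotomy x 0 with hx | rfl | hx
    · have h_neg : Matrix.diagonal ![x, y] = -Matrix.diagonal ![-x, -y] := by
        ext i j
        fin_cases i <;> fin_cases j <;> simp
      rw [h_neg, hiso.apply_neg]
      exact hpos _ _ (neg_pos.2 hx) (by rwa [abs_neg, ← abs_of_neg hx])
    · obtain rfl : y = 0 := by simpa using hxy
      have h_zero : Matrix.diagonal ![(0 : ℝ), 0] = 0 := by
        ext i j
        fin_cases i <;> fin_cases j <;> simp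
      rw [h_zero, hhom.apply_zero hp]
    · exact hpos _ _ hx (by rwa [abs_of_pos hx] at hxy)
  obtain ⟨θ, φ, x, y, rfl⟩ := exists_eq_planeRotation_mul_diagonal_mul A
  rw [hiso.apply_planeRotation] at hA
  rcases le_total |y| |x| with h | h
  · exact hA (hle x y h)
  · exact hA (hiso.apply_diagonal_swap y x ▸ hle y x h)
end
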